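/- For each integer m ≥ 1, let T_m be the set of words w : {0, 1, …, 2m−2} → Bool such that exactly m of the entries of w equal true (hence exactly m−1 equal false), and such that for every k with 0 ≤ k ≤ 2m−2, the number of indices i < k with w i = false is greater than or equal to the number of indices i < k with w i = true. Let μ be the infinite product over ℕ of the uniform probability measure on Bool, and for a word w of length 2m−1 let C_w = { x : ℕ → Bool | x i = w i for all i ≤ 2m−2 } be the corresponding cylinder set. Then the cylinder sets C_w, as m ranges over integers ≥ 1 and w ranges over T_m, are pairwise disjoint and their union has μ-measure 1; equivalently, ∑_{m≥1} (card T_m) · 2^{−(2m−1)} = 1. -/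

import Mathlib

open MeasureTheory

/-- A word `w` of length `2m-1` over `Bool` belongs to `T_m` iff exactly `m` of its entries are
`true` (hence exactly `m-1` are `false`), and in every initial segment of length
`k ≤ 2m-2` the number of `false` entries is at least the number of `true` entries. -/
def MemRuinWords (m : ℕ) (w : Fin (2 * m - 1) → Bool) : Prop :=
  (Finset.univ.filter fun i : Fin (2 * m - 1) => w i = true).card = m ∧
  ∀ k : ℕ, k ≤ 2 * m - 2 →
    (Finset.univ.filter fun i : Fin (2 * m - 1) => (i : ℕ) < k ∧ w i = true).card ≤
      (Finset.univ.filter fun i : Fin (2 * m - 1) => (i : ℕ) < k ∧ w i = false).card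

/-- The cylinder set in `ℕ → Bool` determined by a word `w` of length `2m-1`. -/
def ruinCylinder (m : ℕ) (w : Fin (2 * m - 1) → Bool) : Set (ℕ → Bool) :=
  {x : ℕ → Bool | ∀ i : Fin (2 * m - 1), x i = w i}

/-- Survival probability of the gambler's ruin problem: starting from capital `j`, the gambler is
not ruined within `n` fair rounds. -/
noncomputable def survivalProb : ℕ → ℕ → ℝ
  | 0, 0 => 0
  | 0, _ + 1 => 1
  | _ + 1, 0 => 0
  | n + 1, j + 1 => (survivalProb n j + survivalProb n (j + 2)) / 2

lemma survivalProb_zero_right (n : ℕ) : survivalProb n 0 = 0 := by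
  cases n <;> simp [survivalProb]

lemma survivalProb_mem_Icc (n j : ℕ) : survivalProb n j ∈ Set.Icc (0 : ℝ) 1 := by
  induction n generalizing j with
  | zero => cases j <;> simp [survivalProb]
  | succ n ih =>
    cases j with
    | zero => simp [survivalProb]
    | succ j =>
      have h₁ := ih j
      have h₂ := ih (j + 2)
      simp only [Set.mem_Icc, survivalProb] at *
      constructor <;> linarith

lemma survivalProb_succ_le (n j : ℕ) : survivalProb (n + 1) j ≤ survivalProb n j := by
  induction n generalizing j with
  | zero =>
    cases j with
    | zero => simp [survivalProb]
    | succ j => simpa only [survivalProb] using (survivalProb_mem_Icc 1 (j + 1)).2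
  | succ n ih =>
    cases j with
    | zero => simp [survivalProb]
    | succ j =>
      have h₁ := ih j
      have h₂ := ih (j + 2)
      calc survivalProb (n + 2) (j + 1)
          = (survivalProb (n + 1) j + survivalProb (n + 1) (j + 2)) / 2 := rfl
        _ ≤ (survivalProb n j + survivalProb n (j + 2)) / 2 := by linarith

/-- Eventual ruin is certain: the limit of the survival probabilities is a bounded function of the
capital that is harmonic and vanishes at `0`, hence is `0`. -/
lemma tendsto_survivalProb_one :
    Filter.Tendsto (fun n => survivalProb n 1) Filter.atTop (nhds 0) := by
  have hlim (j : ℕ) : Filter.Tendsto (fun n => survivalProb n j) Filter.atTop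
      (nhds (⨅ n, survivalProb n j)) :=
    tendsto_atTop_ciInf (antitone_nat_of_succ_le fun n => survivalProb_succ_le n j)
      ⟨0, by rintro _ ⟨n, rfl⟩; exact (survivalProb_mem_Icc n j).1⟩
  set p : ℕ → ℝ := fun j => ⨅ n, survivalProb n j with hp
  have hmem (j : ℕ) : p j ∈ Set.Icc (0 : ℝ) 1 :=
    isClosed_Icc.mem_of_tendsto (hlim j) (.of_forall fun n => survivalProb_mem_Icc n j)
  have hzero : p 0 = 0 := by simp [hp, survivalProb_zero_right]
  have hharm (j : ℕ) : p (j + 1) = (p j + p (j + 2)) / 2 :=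
    tendsto_nhds_unique ((Filter.tendsto_add_atTop_iff_nat 1).2 (hlim (j + 1)))
      (((hlim j).add (hlim (j + 2))).div_const 2)
  have hlin (j : ℕ) : p j = j * p 1 ∧ p (j + 1) = (j + 1) * p 1 := by
    induction j with
    | zero => simp [hzero]
    | succ j ih =>
      have := hharm j
      push_cast
      exact ⟨ih.2, by linarith [ih.1, ih.2]⟩
  have hone : p 1 = 0 := by
    refine le_antisymm (not_lt.1 fun hpos => ?_) (hmem 1).1
    obtain ⟨j, hj⟩ := exists_nat_gt (1 / p 1)
    rw [div_lt_iff₀ hpos] at hj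
    linarith [(hlin j).1, (hmem j).2]
  rw [← hone]
  exact hlim 1

/-- The walk with increment `+1` at `true` and `-1` at `false` stays below `j` up to time `n`. -/
def StaysBelow (n j : ℕ) (x : ℕ → Bool) : Prop :=
  ∀ k ≤ n, 2 * Nat.count (fun i => x i = true) k < k + j

lemma not_staysBelow_zero (n : ℕ) (x : ℕ → Bool) : ¬ StaysBelow n 0 x :=
  fun h => by simpa using h 0 n.zero_le

lemma staysBelow_succ_iff (n j : ℕ) (x : ℕ → Bool) :
    StaysBelow (n + 1) (j + 1) x ↔
      StaysBelow n (if x 0 = true then j else j + 2) fun i => x (i + 1) := by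
  have hcount (k : ℕ) : Nat.count (fun i => x i = true) (k + 1) =
      Nat.count (fun i => x (i + 1) = true) k + if x 0 = true then 1 else 0 :=
    Nat.count_succ' _ _
  constructor
  · intro h k hk
    have := h (k + 1) (by omega)
    rw [hcount] at this
    beta_reduce
    split_ifs at this ⊢ <;> omega
  · rintro h (_ | k) hk
    · simp
    · have := h k (by omega)
      beta_reduce at this
      rw [hcount]
      split_ifs at this ⊢ <;> omega

lemma measureReal_cylinder_inter_staysBelow (μ : Measure (ℕ → Bool)) [IsProbabilityMeasure μ]
    (hμ : ∀ (s : Finset ℕ) (b : ℕ → Bool),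
      μ {x : ℕ → Bool | ∀ i ∈ s, x i = b i} = (1 / 2 : ENNReal) ^ s.card)
    (n j l : ℕ) (b : ℕ → Bool) :
    μ.real {x | (∀ i < l, x i = b i) ∧ StaysBelow n j fun i => x (i + l)} =
      (1 / 2) ^ l * survivalProb n j := by
  induction n generalizing j l b with
  | zero =>
    cases j with
    | zero => simp [not_staysBelow_zero, survivalProb]
    | succ j =>
      have := hμ (Finset.range l) b
      simp only [Finset.mem_range, Finset.card_range] at this
      simp [StaysBelow, survivalProb, Measure.real, this]
  | succ n ih =>
    cases j with
    | zero => simp [not_staysBelow_zero, survivalProb]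
    | succ j =>
      have hprefix (c : Bool) (x : ℕ → Bool) :
          (∀ i < l + 1, x i = Function.update b l c i) ↔ (∀ i < l, x i = b i) ∧ x l = c := by
        rw [Nat.forall_lt_succ_right]
        refine and_congr (forall₂_congr fun i hi => ?_) (by simp)
        rw [Function.update_of_ne hi.ne]
      have htrue := ih j (l + 1) (Function.update b l true)
      have hfalse := ih (j + 2) (l + 1) (Function.update b l false)
      have hmeas : MeasurableSet {x : ℕ → Bool | x l = true} :=
        measurableSet_eq_fun (measurable_pi_apply l) measurable_const
      rw [← measureReal_inter_add_sdiff hmeas]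
      have hstep (x : ℕ → Bool) : StaysBelow (n + 1) (j + 1) (fun i => x (i + l)) ↔
          StaysBelow n (if x l = true then j else j + 2) fun i => x (i + (l + 1)) := by
        rw [staysBelow_succ_iff]
        simp only [zero_add, add_assoc, add_comm 1 l]
      have hinter : {x : ℕ → Bool | (∀ i < l, x i = b i) ∧
            StaysBelow (n + 1) (j + 1) fun i => x (i + l)} ∩ {x | x l = true} =
          {x | (∀ i < l + 1, x i = Function.update b l true i) ∧
            StaysBelow n j fun i => x (i + (l + 1))} := by
        ext x
        simp only [Set.mem_inter_iff, Set.mem_ofPred_eq, hprefix, hstep]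
        by_cases hx : x l = true <;> simp [hx]
      have hdiff : {x : ℕ → Bool | (∀ i < l, x i = b i) ∧
            StaysBelow (n + 1) (j + 1) fun i => x (i + l)} \ {x | x l = true} =
          {x | (∀ i < l + 1, x i = Function.update b l false i) ∧
            StaysBelow n (j + 2) fun i => x (i + (l + 1))} := by
        ext x
        simp only [Set.mem_sdiff, Set.mem_ofPred_eq, hprefix, hstep]
        by_cases hx : x l = true <;> simp [hx]
      rw [hinter, hdiff, htrue, hfalse, survivalProb]
      ring

lemma measure_forall_staysBelow_one (μ : Measure (ℕ → Bool)) [IsProbabilityMeasure μ]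
    (hμ : ∀ (s : Finset ℕ) (b : ℕ → Bool),
      μ {x : ℕ → Bool | ∀ i ∈ s, x i = b i} = (1 / 2 : ENNReal) ^ s.card) :
    μ {x | ∀ n, StaysBelow n 1 x} = 0 := by
  rw [← measureReal_eq_zero_iff]
  refine le_antisymm (ge_of_tendsto' tendsto_survivalProb_one fun n => ?_) measureReal_nonneg
  have := measureReal_cylinder_inter_staysBelow μ hμ n 1 0 fun _ => true
  simp only [not_lt_zero, false_imp_iff, implies_true, true_and, add_zero, pow_zero,
    one_mul] at this
  rw [← this]
  exact measureReal_mono fun x hx => hx n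

lemma count_true_add_count_false (x : ℕ → Bool) (k : ℕ) :
    Nat.count (fun i => x i = true) k + Nat.count (fun i => x i = false) k = k := by
  induction k with
  | zero => simp
  | succ k ih =>
    rw [Nat.count_succ, Nat.count_succ]
    cases x k <;> simp <;> omega

lemma card_filter_eq_count {N : ℕ} {w : Fin N → Bool} {x : ℕ → Bool}
    (hx : ∀ i : Fin N, x i = w i) (c : Bool) {k : ℕ} (hk : k ≤ N) :
    (Finset.univ.filter fun i : Fin N => (i : ℕ) < k ∧ w i = c).card =
      Nat.count (fun i => x i = c) k := by
  rw [Nat.count_eq_card_filter_range, ← Finset.card_map Fin.valEmbedding]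
  congr 1
  ext i
  simp only [Finset.mem_map, Finset.mem_filter, Finset.mem_univ, true_and, Finset.mem_range,
    Fin.valEmbedding_apply]
  constructor
  · rintro ⟨i, ⟨hi, hw⟩, rfl⟩
    exact ⟨hi, (hx i).trans hw⟩
  · rintro ⟨hi, hc⟩
    exact ⟨⟨i, by omega⟩, ⟨hi, (hx ⟨i, by omega⟩).symm.trans hc⟩, rfl⟩

lemma memRuinWords_iff_count {m : ℕ} {w : Fin (2 * m - 1) → Bool} {x : ℕ → Bool}
    (hx : x ∈ ruinCylinder m w) :
    MemRuinWords m w ↔ Nat.count (fun i => x i = true) (2 * m - 1) = m ∧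
      ∀ k ≤ 2 * m - 2, 2 * Nat.count (fun i => x i = true) k < k + 1 := by
  have hall := card_filter_eq_count hx true le_rfl
  simp only [Fin.is_lt, true_and] at hall
  rw [MemRuinWords, hall]
  refine and_congr_right fun _ => forall₂_congr fun k hk => ?_
  rw [card_filter_eq_count hx true (by omega), card_filter_eq_count hx false (by omega)]
  have := count_true_add_count_false x k
  omega

lemma disjoint_ruinCylinder {p q : Σ m : ℕ, Fin (2 * m - 1) → Bool}
    (hp : 1 ≤ p.1) (hpw : MemRuinWords p.1 p.2) (hq : 1 ≤ q.1) (hqw : MemRuinWords q.1 q.2)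
    (hpq : p ≠ q) : Disjoint (ruinCylinder p.1 p.2) (ruinCylinder q.1 q.2) := by
  rw [Set.disjoint_left]
  intro x hxp hxq
  obtain ⟨m, w⟩ := p
  obtain ⟨m', w'⟩ := q
  obtain ⟨hc, hlt⟩ := (memRuinWords_iff_count hxp).1 hpw
  obtain ⟨hc', hlt'⟩ := (memRuinWords_iff_count hxq).1 hqw
  dsimp only at *
  rcases lt_trichotomy m m' with h | rfl | h
  · have := hlt' (2 * m - 1) (by omega)
    omega
  · exact hpq (congrArg _ (funext fun i => (hxp i).symm.trans (hxq i)))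
  · have := hlt (2 * m' - 1) (by omega)
    omega

lemma exists_mem_ruinCylinder {x : ℕ → Bool} (hx : ¬ ∀ n, StaysBelow n 1 x) :
    ∃ m w, 1 ≤ m ∧ MemRuinWords m w ∧ x ∈ ruinCylinder m w := by
  have hex : ∃ k, k + 1 ≤ 2 * Nat.count (fun i => x i = true) k := by
    simp only [StaysBelow, not_forall, not_lt] at hx
    obtain ⟨-, k, -, hk⟩ := hx
    exact ⟨k, hk⟩
  classical
  obtain ⟨hk, hmin⟩ := (Nat.find_eq_iff hex).1 rfl
  generalize Nat.find hex = k at hk hmin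
  obtain _ | k := k
  · simp at hk
  have hprev := hmin k (by omega)
  set m := Nat.count (fun i => x i = true) (k + 1) with hm
  have hle : m ≤ Nat.count (fun i => x i = true) k + 1 := by
    rw [hm, Nat.count_succ]
    split_ifs <;> omega
  have hlen : 2 * m - 1 = k + 1 := by omega
  have hmem : x ∈ ruinCylinder m fun i => x i := fun _ => rfl
  refine ⟨m, fun i => x i, by omega, (memRuinWords_iff_count hmem).2 ⟨?_, fun i hi => ?_⟩, hmem⟩
  · rw [hlen]
  · have := hmin i (by omega)
    omega

lemma measurableSet_ruinCylinder (m : ℕ) (w : Fin (2 * m - 1) → Bool) :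
    MeasurableSet (ruinCylinder m w) := by
  simp only [ruinCylinder, Set.ofPred_forall]
  exact .iInter fun i => measurableSet_eq_fun (measurable_pi_apply (i : ℕ)) measurable_const

lemma measure_ruinCylinder (μ : Measure (ℕ → Bool))
    (hμ : ∀ (s : Finset ℕ) (b : ℕ → Bool),
      μ {x : ℕ → Bool | ∀ i ∈ s, x i = b i} = (1 / 2 : ENNReal) ^ s.card)
    (m : ℕ) (w : Fin (2 * m - 1) → Bool) :
    μ (ruinCylinder m w) = (1 / 2 : ENNReal) ^ (2 * m - 1) := by
  have := hμ (Finset.range (2 * m - 1)) fun i => if h : i < 2 * m - 1 then w ⟨i, h⟩ else true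
  rw [Finset.card_range] at this
  rw [← this]
  congr 1
  ext x
  simp only [ruinCylinder, Set.mem_ofPred_eq, Fin.forall_iff, Finset.mem_range]
  exact forall₂_congr fun i hi => by rw [dif_pos hi]

/-- Let `μ` be the infinite product over `ℕ` of the uniform probability measure on `Bool`
(characterized by the fact that every cylinder set determined by prescribing the coordinates
in a finite set `s` has measure `(1/2)^s.card`). Then the cylinder sets `C_w`, as `m` ranges
over integers `≥ 1` and `w` ranges over `T_m`, are pairwise disjoint and their union has
`μ`-measure `1`; equivalently, `∑_{m ≥ 1} (card T_m) · 2^{-(2m-1)} = 1`. -/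
theorem ruinCylinders_disjoint_and_full_measure
    (μ : Measure (ℕ → Bool)) [IsProbabilityMeasure μ]
    (hμ : ∀ (s : Finset ℕ) (b : ℕ → Bool),
      μ {x : ℕ → Bool | ∀ i ∈ s, x i = b i} = (1 / 2 : ENNReal) ^ s.card) :
    (∀ p q : Σ m : ℕ, Fin (2 * m - 1) → Bool,
        1 ≤ p.1 → MemRuinWords p.1 p.2 → 1 ≤ q.1 → MemRuinWords q.1 q.2 → p ≠ q →
        Disjoint (ruinCylinder p.1 p.2) (ruinCylinder q.1 q.2)) ∧
    μ (⋃ p ∈ {p : Σ m : ℕ, Fin (2 * m - 1) → Bool | 1 ≤ p.1 ∧ MemRuinWords p.1 p.2},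
        ruinCylinder p.1 p.2) = 1 ∧
    (∑' m : ℕ, if 1 ≤ m then
        (Nat.card {w : Fin (2 * m - 1) → Bool // MemRuinWords m w} : ENNReal) *
          (1 / 2 : ENNReal) ^ (2 * m - 1)
      else 0) = 1 := by
  set S : Set (Σ m : ℕ, Fin (2 * m - 1) → Bool) := {p | 1 ≤ p.1 ∧ MemRuinWords p.1 p.2} with hS
  have hunion : μ (⋃ p ∈ S, ruinCylinder p.1 p.2) = 1 := by
    rw [← prob_compl_eq_zero_iff
      (.biUnion S.to_countable fun p _ => measurableSet_ruinCylinder p.1 p.2)]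
    refine measure_mono_null (fun x hx => ?_) (measure_forall_staysBelow_one μ hμ)
    by_contra h
    obtain ⟨m, w, hm, hw, hxw⟩ := exists_mem_ruinCylinder h
    exact hx (Set.mem_biUnion (x := ⟨m, w⟩) ⟨hm, hw⟩ hxw)
  refine ⟨fun p q hp hpw hq hqw => disjoint_ruinCylinder hp hpw hq hqw, hunion, ?_⟩
  rw [measure_biUnion S.to_countable
    (fun p hp q hq => disjoint_ruinCylinder hp.1 hp.2 hq.1 hq.2)
    (fun p _ => measurableSet_ruinCylinder p.1 p.2),
    tsum_subtype S fun p => μ (ruinCylinder p.1 p.2), ENNReal.tsum_sigma'] at hunion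
  refine Eq.trans ?_ hunion
  refine tsum_congr fun m => ?_
  classical
  split_ifs with hm
  · simp only [Set.indicator_apply, hS, Set.mem_ofPred_eq, hm, true_and,
      measure_ruinCylinder μ hμ]
    rw [tsum_fintype, ← Finset.sum_filter, Finset.sum_const, nsmul_eq_mul,
      Nat.card_eq_fintype_card, Fintype.card_subtype]
  · simp [hS, hm]
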